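/- Let G = A_1(4) act on ℂ[Z_1,Z_2,Z_3,Z_4] by g·Z_i = g_{ii} Z_i, and let I_G denote the ideal generated by the G-invariant polynomials without constant term, i.e. I_G = ⟨Z_1^2, Z_2^2, Z_3^2, Z_4^2, Z_1Z_2Z_3Z_4⟩. Then the ideal I = ⟨Z_2Z_3Z_4, Z_1Z_2, Z_1Z_3, Z_1Z_4⟩ + I_G is G-invariant, the quotient ℂ[Z_1,…,Z_4]/I has dimension 8 with basis the classes of 1, Z_1, Z_2, Z_3, Z_4, Z_2Z_3, Z_2Z_4, Z_3Z_4, and it is isomorphic to the regular representation of G, i.e. each of the 8 characters of G occurs in it with multiplicity one. -/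

import Mathlib

open MvPolynomial

noncomputable section

/-- The abelian group `A_r(n)`: diagonal matrices (encoded as tuples of units)
`d` with `d i ^ (r+1) = 1` for all `i` and `∏ i, d i = 1` (determinant one). -/
def ArGroup (r n : ℕ) : Subgroup (Fin n → ℂˣ) where
  carrier := {d | (∀ i, d i ^ (r + 1) = 1) ∧ ∏ i, d i = 1}
  one_mem' := ⟨fun _ => one_pow _, Finset.prod_const_one⟩
  mul_mem' := by
    rintro a b ⟨ha1, ha2⟩ ⟨hb1, hb2⟩
    refine ⟨fun i => ?_, ?_⟩
    · simp [Pi.mul_apply, mul_pow, ha1 i, hb1 i]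
    · simp [Finset.prod_mul_distrib, ha2, hb2]
  inv_mem' := by
    rintro a ⟨ha1, ha2⟩
    refine ⟨fun i => ?_, ?_⟩
    · rw [Pi.inv_apply, inv_pow, ha1 i, inv_one]
    · simp [Finset.prod_inv_distrib, ha2]

/-- The action of a diagonal element `d` on polynomials, `Z i ↦ d i • Z i`. -/
def actA {n : ℕ} (d : Fin n → ℂˣ) :
    MvPolynomial (Fin n) ℂ →ₐ[ℂ] MvPolynomial (Fin n) ℂ :=
  aeval fun i => C (d i : ℂ) * X i

/-- The `ρ`-isotypic component (as a set) of the `A_r(n)`-module `ℂ[Z]/I`: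
those classes `w` such that for every `g` in the group and every representative `p`
of `w`, the class of `g · p` equals `ρ(g) • w`. -/
def iso (r n : ℕ) (I : Ideal (MvPolynomial (Fin n) ℂ)) (ρ : ArGroup r n →* ℂˣ) :
    Set (MvPolynomial (Fin n) ℂ ⧸ I) :=
  {w | ∀ g : ArGroup r n, ∀ p, Ideal.Quotient.mk I p = w →
    Ideal.Quotient.mk I (actA (g : Fin n → ℂˣ) p) = (ρ g : ℂ) • w}

end

open Finsupp in
/-- The exponents of the monomials `1, Z_1, Z_2, Z_3, Z_4, Z_2Z_3, Z_2Z_4, Z_3Z_4`. -/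
noncomputable def standardExponent : Fin 8 → (Fin 4 →₀ ℕ) :=
  ![0, single 0 1, single 1 1, single 2 1, single 3 1,
    single 1 1 + single 2 1, single 1 1 + single 3 1, single 2 1 + single 3 1]

open Finsupp in
/-- The exponents of the nine monomials generating the ideal. -/
noncomputable def generatorExponents : Set (Fin 4 →₀ ℕ) :=
  {single 1 1 + single 2 1 + single 3 1, single 0 1 + single 1 1, single 0 1 + single 2 1,
    single 0 1 + single 3 1, single 0 2, single 1 2, single 2 2, single 3 2,
    single 0 1 + single 1 1 + single 2 1 + single 3 1}

theorem standardExponent_injective : Function.Injective standardExponent := by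
  have key : ∀ i j, (∀ k, standardExponent i k = standardExponent j k) → i = j := by
    intro i j h
    have h0 := h 0
    have h1 := h 1
    have h2 := h 2
    have h3 := h 3
    fin_cases i <;> fin_cases j <;>
      simp [standardExponent] at h0 h1 h2 h3 ⊢
  exact fun i j h => key i j fun k => by rw [h]

theorem exists_generatorExponents_le_iff (m : Fin 4 →₀ ℕ) :
    (∃ s ∈ generatorExponents, s ≤ m) ↔ ∀ i, standardExponent i ≠ m := by
  simp only [generatorExponents, Set.mem_insert_iff, Set.mem_singleton_iff, exists_eq_or_imp,
    exists_eq_left]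
  simp only [Finsupp.le_def, Fin.forall_fin_succ, ne_eq, Finsupp.ext_iff]
  simp [standardExponent, Finsupp.single_apply, Fin.ext_iff]
  generalize m 0 = a, m 1 = b, m 2 = c, m 3 = d
  clear m
  constructor
  · rintro (h | h | h | h | h | h | h | h | h) <;> refine ⟨?_, ?_, ?_, ?_, ?_, ?_, ?_, ?_⟩ <;> omega
  · intro h
    by_contra! h'
    have ha : a < 2 := by tauto
    have hb : b < 2 := by tauto
    have hc : c < 2 := by tauto
    have hd : d < 2 := by tauto
    interval_cases a <;> interval_cases b <;> interval_cases c <;> interval_cases d <;> simp_all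

theorem mem_span_generatorExponents_iff (p : MvPolynomial (Fin 4) ℂ) :
    p ∈ Ideal.span ((fun s => monomial s (1 : ℂ)) '' generatorExponents) ↔
      ∀ i, coeff (standardExponent i) p = 0 := by
  simp only [mem_ideal_span_monomial_image, exists_generatorExponents_le_iff, mem_support_iff]
  constructor
  · intro h i
    by_contra hi
    exact h _ hi i rfl
  · rintro h m hm i rfl
    exact hm (h i)

/-- The character by which `A_r(n)` acts on the monomial with exponent `m`. -/
def monomialCharacter (r n : ℕ) (m : Fin n →₀ ℕ) : ArGroup r n →* ℂˣ where
  toFun g := ∏ i, (g : Fin n → ℂˣ) i ^ m i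
  map_one' := by simp
  map_mul' g h := by simp [mul_pow, Finset.prod_mul_distrib]

theorem coeff_actA {r n : ℕ} (g : ArGroup r n) (m : Fin n →₀ ℕ) (p : MvPolynomial (Fin n) ℂ) :
    coeff m (actA (g : Fin n → ℂˣ) p) = monomialCharacter r n m g * coeff m p := by
  induction p using MvPolynomial.induction_on' with
  | monomial u a =>
    have h : actA (g : Fin n → ℂˣ) (monomial u a) =
        C (monomialCharacter r n u g : ℂ) * monomial u a := by
      rw [actA, aeval_monomial, monomial_eq, Finsupp.prod_fintype _ _ (by simp),
        Finsupp.prod_fintype _ _ (by simp)]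
      simp only [mul_pow, Finset.prod_mul_distrib, monomialCharacter, MonoidHom.coe_mk,
        OneHom.coe_mk, Units.coe_prod, Units.val_pow_eq_pow_val, map_prod, map_pow,
        algebraMap_eq]
      ring
    rw [h, coeff_C_mul, coeff_monomial]
    split_ifs with hu
    · rw [hu]
    · simp
  | add p q hp hq => simp [hp, hq, mul_add]

section MonomialQuotient

variable {ι : Type*} [Fintype ι] [DecidableEq ι] {n : ℕ} {e : ι → (Fin n →₀ ℕ)}
  {I : Ideal (MvPolynomial (Fin n) ℂ)}

/-- If `I` consists of the polynomials whose coefficients at the exponents `e i` vanish, these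
coefficients are coordinates on the quotient by `I`. -/
noncomputable def quotientCoeffEquiv (he : Function.Injective e)
    (hI : ∀ p, p ∈ I ↔ ∀ i, coeff (e i) p = 0) :
    (MvPolynomial (Fin n) ℂ ⧸ I) ≃ₗ[ℂ] (ι → ℂ) :=
  LinearEquiv.ofBijective
    ((I.restrictScalars ℂ).liftQ (LinearMap.pi fun i => lcoeff ℂ (e i))
      fun p hp => by ext i; exact (hI p).1 hp i :
      (MvPolynomial (Fin n) ℂ ⧸ I) →ₗ[ℂ] (ι → ℂ)) <| by
    constructor
    · rw [injective_iff_map_eq_zero]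
      intro w hw
      obtain ⟨p, rfl⟩ := Ideal.Quotient.mk_surjective w
      exact Ideal.Quotient.eq_zero_iff_mem.2 ((hI p).2 fun i => congrFun hw i)
    · intro f
      refine ⟨Ideal.Quotient.mk I (∑ i, monomial (e i) (f i)), ?_⟩
      ext j
      change coeff (e j) (∑ i, monomial (e i) (f i)) = f j
      simp [coeff_sum, coeff_monomial, he.eq_iff]

theorem quotientCoeffEquiv_mk (he : Function.Injective e)
    (hI : ∀ p, p ∈ I ↔ ∀ i, coeff (e i) p = 0) (p : MvPolynomial (Fin n) ℂ) (i : ι) :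
    quotientCoeffEquiv he hI (Ideal.Quotient.mk I p) i = coeff (e i) p := rfl

/-- The classes of the monomials with exponents `e i` as a basis of the quotient. -/
noncomputable def quotientMonomialBasis (he : Function.Injective e)
    (hI : ∀ p, p ∈ I ↔ ∀ i, coeff (e i) p = 0) :
    Module.Basis ι ℂ (MvPolynomial (Fin n) ℂ ⧸ I) :=
  Module.Basis.ofEquivFun (quotientCoeffEquiv he hI)

theorem quotientMonomialBasis_apply (he : Function.Injective e)
    (hI : ∀ p, p ∈ I ↔ ∀ i, coeff (e i) p = 0) (i : ι) :
    quotientMonomialBasis he hI i = Ideal.Quotient.mk I (monomial (e i) 1) := by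
  apply (quotientCoeffEquiv he hI).injective
  ext j
  rw [quotientCoeffEquiv_mk, coeff_monomial]
  simp [quotientMonomialBasis, Module.Basis.coe_ofEquivFun, Pi.single_apply, he.eq_iff,
    eq_comm]

theorem mem_iso_iff (he : Function.Injective e) (hI : ∀ p, p ∈ I ↔ ∀ i, coeff (e i) p = 0)
    {r : ℕ} (ρ : ArGroup r n →* ℂˣ) (w : MvPolynomial (Fin n) ℂ ⧸ I) :
    w ∈ iso r n I ρ ↔
      ∀ i, monomialCharacter r n (e i) ≠ ρ → quotientCoeffEquiv he hI w i = 0 := by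
  constructor
  · intro hw i hi
    obtain ⟨p, rfl⟩ := Ideal.Quotient.mk_surjective w
    by_contra h0
    refine hi (MonoidHom.ext fun g => Units.ext ?_)
    have h := congrArg (fun v => quotientCoeffEquiv he hI v i) (hw g p rfl)
    simp only [map_smul, Pi.smul_apply, smul_eq_mul, quotientCoeffEquiv_mk, coeff_actA] at h h0
    exact mul_right_cancel₀ h0 h
  · rintro h g p rfl
    apply (quotientCoeffEquiv he hI).injective
    ext i
    simp only [map_smul, Pi.smul_apply, smul_eq_mul, quotientCoeffEquiv_mk, coeff_actA] at h ⊢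
    by_cases hi : monomialCharacter r n (e i) = ρ
    · rw [hi]
    · simp [h i hi]

theorem exists_mem_iso_generator (he : Function.Injective e)
    (hI : ∀ p, p ∈ I ↔ ∀ i, coeff (e i) p = 0) {r : ℕ} (ρ : ArGroup r n →* ℂˣ)
    (hρ : ∃! i, monomialCharacter r n (e i) = ρ) :
    ∃ w ∈ iso r n I ρ, w ≠ 0 ∧ ∀ w' ∈ iso r n I ρ, ∃ a : ℂ, w' = a • w := by
  obtain ⟨i, hi, hu⟩ := hρ
  refine ⟨Ideal.Quotient.mk I (monomial (e i) 1), ?_, ?_, fun w hw => ?_⟩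
  · rw [mem_iso_iff he hI]
    intro j hj
    rw [quotientCoeffEquiv_mk, coeff_monomial, if_neg]
    intro hij
    exact hj (hij ▸ hi)
  · rw [← quotientMonomialBasis_apply he hI]
    exact (quotientMonomialBasis he hI).ne_zero i
  · rw [mem_iso_iff he hI] at hw
    refine ⟨quotientCoeffEquiv he hI w i, (quotientCoeffEquiv he hI).injective ?_⟩
    ext j
    rw [map_smul, Pi.smul_apply, quotientCoeffEquiv_mk, coeff_monomial]
    by_cases hj : j = i
    · simp [hj]
    · rw [hw j fun h => hj (hu j h), if_neg fun h => hj (he h.symm), smul_zero]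

end MonomialQuotient

/-- The element of `A_1(4)` with entries `-1` exactly at the indices `0` and `k + 1`. -/
def flipGenerator (k : Fin 3) : ArGroup 1 4 :=
  ⟨Fin.cons (-1) (Pi.mulSingle k (-1)), by
    constructor
    · intro i
      cases i using Fin.cases with
      | zero => simp
      | succ j =>
        rw [Fin.cons_succ, Pi.mulSingle_apply]
        split_ifs <;> simp
    · simp [Fin.prod_univ_succ (n := 3)]⟩

theorem flipGenerator_apply (k : Fin 3) (i : Fin 4) :
    (flipGenerator k : Fin 4 → ℂˣ) i = if i = 0 ∨ i = k.succ then -1 else 1 := by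
  cases i using Fin.cases with
  | zero => simp [flipGenerator]
  | succ j => simp [flipGenerator, Pi.mulSingle_apply]

theorem eq_one_or_neg_one_of_sq_eq_one {u : ℂˣ} (hu : u ^ 2 = 1) : u = 1 ∨ u = -1 := by
  have h := congrArg Units.val hu
  rw [Units.val_pow_eq_pow_val, Units.val_one, sq_eq_one_iff] at h
  exact h.imp (fun h => Units.ext h) (fun h => Units.ext (by simpa using h))

theorem monomialCharacter_flipGenerator (m : Fin 4 →₀ ℕ) (k : Fin 3) :
    monomialCharacter 1 4 m (flipGenerator k) = (-1) ^ m 0 * (-1) ^ m k.succ := by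
  simp [monomialCharacter, Fin.prod_univ_succ (n := 3), flipGenerator, Pi.mulSingle_apply,
    ite_pow]

theorem eq_prod_flipGenerator (g : ArGroup 1 4) :
    g = ∏ k : Fin 3, if (g : Fin 4 → ℂˣ) k.succ = 1 then 1 else flipGenerator k := by
  obtain ⟨d, hd, hprod⟩ := g
  have hsign : ∀ i, d i = 1 ∨ d i = -1 := fun i => eq_one_or_neg_one_of_sq_eq_one (hd i)
  rw [Fin.prod_univ_four] at hprod
  have h0 : d 0 = d 1 * d 2 * d 3 := by
    rcases hsign 1 with h1 | h1 <;> rcases hsign 2 with h2 | h2 <;>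
      rcases hsign 3 with h3 | h3 <;> simp_all [neg_eq_iff_eq_neg]
  apply Subtype.ext
  funext i
  rcases hsign 1 with h1 | h1 <;> rcases hsign 2 with h2 | h2 <;>
    rcases hsign 3 with h3 | h3 <;> fin_cases i <;>
    simp [Fin.prod_univ_three, flipGenerator_apply, h0, h1, h2, h3, Fin.ext_iff]

theorem closure_range_flipGenerator : Subgroup.closure (Set.range flipGenerator) = ⊤ := by
  refine eq_top_iff.2 fun g _ => ?_
  rw [eq_prod_flipGenerator g]
  refine Subgroup.prod_mem _ fun k _ => ?_
  split_ifs
  · exact one_mem _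
  · exact Subgroup.subset_closure ⟨k, rfl⟩

theorem existsUnique_monomialCharacter_eq (ρ : ArGroup 1 4 →* ℂˣ) :
    ∃! i, monomialCharacter 1 4 (standardExponent i) = ρ := by
  have hρ : ∀ k, ρ (flipGenerator k) = 1 ∨ ρ (flipGenerator k) = -1 := fun k => by
    have hsq : flipGenerator k ^ 2 = 1 := Subtype.ext (funext (flipGenerator k).2.1)
    exact eq_one_or_neg_one_of_sq_eq_one (by rw [← map_pow, hsq, map_one])
  have hiff : ∀ i, monomialCharacter 1 4 (standardExponent i) = ρ ↔
      ∀ k, monomialCharacter 1 4 (standardExponent i) (flipGenerator k) = ρ (flipGenerator k) :=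
    fun i => ⟨fun h k => by rw [h], fun h =>
      MonoidHom.eq_of_eqOn_dense closure_range_flipGenerator (by rintro _ ⟨k, rfl⟩; exact h k)⟩
  simp only [hiff, monomialCharacter_flipGenerator, ExistsUnique, Fin.forall_fin_succ,
    Fin.exists_fin_succ]
  rcases hρ 0 with h0 | h0 <;> rcases hρ 1 with h1 | h1 <;> rcases hρ 2 with h2 | h2 <;>
    simp [standardExponent, Finsupp.single_apply, h0, h1, h2]

/-- For `G = A_1(4)`, with `I_G = ⟨Z_1^2, Z_2^2, Z_3^2, Z_4^2,
Z_1Z_2Z_3Z_4⟩`, the ideal `I = ⟨Z_2Z_3Z_4, Z_1Z_2, Z_1Z_3, Z_1Z_4⟩ + I_G` is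
`G`-invariant, the quotient has dimension `8` with basis the classes of
`1, Z_1, Z_2, Z_3, Z_4, Z_2Z_3, Z_2Z_4, Z_3Z_4`, and each of the `8` characters of
`G` occurs in it with multiplicity one. -/
theorem A14_ideal_xC1_regular :
    let IG : Ideal (MvPolynomial (Fin 4) ℂ) :=
      Ideal.span {(X 0 : MvPolynomial (Fin 4) ℂ) ^ 2, X 1 ^ 2, X 2 ^ 2, X 3 ^ 2,
        X 0 * X 1 * X 2 * X 3}
    let I : Ideal (MvPolynomial (Fin 4) ℂ) :=
      Ideal.span {(X 1 : MvPolynomial (Fin 4) ℂ) * X 2 * X 3,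
        X 0 * X 1, X 0 * X 2, X 0 * X 3} ⊔ IG
    let fam : Fin 8 → MvPolynomial (Fin 4) ℂ ⧸ I :=
      ![Ideal.Quotient.mk I 1, Ideal.Quotient.mk I (X 0), Ideal.Quotient.mk I (X 1),
        Ideal.Quotient.mk I (X 2), Ideal.Quotient.mk I (X 3),
        Ideal.Quotient.mk I (X 1 * X 2), Ideal.Quotient.mk I (X 1 * X 3),
        Ideal.Quotient.mk I (X 2 * X 3)]
    (∀ g : ArGroup 1 4, ∀ p ∈ I, actA (g : Fin 4 → ℂˣ) p ∈ I) ∧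
    Module.finrank ℂ (MvPolynomial (Fin 4) ℂ ⧸ I) = 8 ∧
    LinearIndependent ℂ fam ∧
    Submodule.span ℂ (Set.range fam) = ⊤ ∧
    ∀ ρ : ArGroup 1 4 →* ℂˣ,
      ∃ w ∈ iso 1 4 I ρ, w ≠ 0 ∧ ∀ w' ∈ iso 1 4 I ρ, ∃ a : ℂ, w' = a • w := by
  intro IG I fam
  have hspan : I = Ideal.span ((fun s => monomial s (1 : ℂ)) '' generatorExponents) := by
    simp only [I, IG, ← Ideal.span_union, generatorExponents, Set.image_insert_eq,
      Set.image_singleton, X, monomial_mul, mul_one, Set.insert_union,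
      Set.singleton_union, one_pow, monomial_pow, Finsupp.smul_single, smul_eq_mul]
  have hI : ∀ p, p ∈ I ↔ ∀ i, coeff (standardExponent i) p = 0 := fun p => by
    rw [hspan, mem_span_generatorExponents_iff]
  have hfam : fam = quotientMonomialBasis standardExponent_injective hI := by
    funext i
    rw [quotientMonomialBasis_apply]
    fin_cases i <;> simp [fam, standardExponent, X, monomial_mul]
  refine ⟨fun g p hp => ?_, ?_, ?_, ?_, fun ρ => ?_⟩
  · rw [hI] at hp ⊢
    intro i
    rw [coeff_actA, hp i, mul_zero]
  · simpa using Module.finrank_eq_card_basis (quotientMonomialBasis standardExponent_injective hI)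
  · rw [hfam]
    exact Module.Basis.linearIndependent _
  · rw [hfam]
    exact Module.Basis.span_eq _
  · exact exists_mem_iso_generator standardExponent_injective hI ρ
      (existsUnique_monomialCharacter_eq ρ)
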